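/- Let n ≥ 4, let a be a point of an n-element set, and let H be a subgroup of the symmetric group S_n on that set. Suppose H contains every even permutation that fixes a, H contains some permutation π with π(a) ≠ a, and H contains some odd permutation. Then H = S_n. -/

import Mathlib

open Equiv Equiv.Perm

/-- If `a` is fixed and `b ≠ x` are other points, some even permutation fixes `a` and sends
`b` to `x`. -/
theorem exists_sign_eq_one_fix_map {α : Type*} [Fintype α] [DecidableEq α]
    (hα : 4 ≤ Fintype.card α) {a b x : α} (hb : b ≠ a) (hx : x ≠ a) (hbx : b ≠ x) :
    ∃ σ : Perm α, sign σ = 1 ∧ σ a = a ∧ σ b = x := by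
  obtain ⟨c, hc⟩ : ∃ c, c ∉ ({a, b, x} : Finset α) := by
    by_contra! h
    have hcard := (Finset.card_le_card fun c (_ : c ∈ Finset.univ) => h c).trans
      Finset.card_le_three
    rw [Finset.card_univ] at hcard
    lia
  simp only [Finset.mem_insert, Finset.mem_singleton, not_or] at hc
  obtain ⟨hca, hcb, hcx⟩ := hc
  refine ⟨swap b x * swap x c, ?_, ?_, ?_⟩
  · rw [Perm.sign_mul, sign_swap hbx, sign_swap (Ne.symm hcx)]
    rfl
  · rw [Perm.mul_apply, swap_apply_of_ne_of_ne hx.symm (Ne.symm hca),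
      swap_apply_of_ne_of_ne hb.symm hx.symm]
  · rw [Perm.mul_apply, swap_apply_of_ne_of_ne hbx (Ne.symm hcb), swap_apply_left]

/-- Let `n ≥ 4`, let `a` be a point of an `n`-element set, and let `H` be a subgroup
of the symmetric group on that set. Suppose `H` contains every even permutation
fixing `a`, `H` contains some permutation moving `a`, and `H` contains some odd
permutation. Then `H` is the full symmetric group. -/
theorem stmt_16 (n : ℕ) (hn : 4 ≤ n) (a : Fin n) (H : Subgroup (Equiv.Perm (Fin n)))
    (h_even_fix : ∀ π : Equiv.Perm (Fin n), Equiv.Perm.sign π = 1 → π a = a → π ∈ H)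
    (h_move : ∃ π ∈ H, π a ≠ a)
    (h_odd : ∃ π ∈ H, Equiv.Perm.sign π = -1) :
    H = ⊤ := by
  have hcard : 4 ≤ Fintype.card (Fin n) := by rwa [Fintype.card_fin]
  have h_trans : ∀ x, ∃ g ∈ H, g a = x := by
    intro x
    obtain ⟨π, hπ, hπa⟩ := h_move
    by_cases hxa : x = a
    · exact ⟨1, H.one_mem, hxa.symm⟩
    by_cases hπx : π a = x
    · exact ⟨π, hπ, hπx⟩
    obtain ⟨σ, hσ, hσa, hσx⟩ := exists_sign_eq_one_fix_map hcard hπa hxa hπx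
    exact ⟨σ * π, H.mul_mem (h_even_fix σ hσ hσa) hπ, hσx⟩
  have h_fix : ∀ y σ, sign σ = 1 → σ y = y → σ ∈ H := by
    intro y σ hσ hσy
    obtain ⟨g, hg, rfl⟩ := h_trans y
    have hconj : g⁻¹ * σ * g ∈ H := by
      apply h_even_fix
      · simp [hσ]
      · simp [hσy]
    rwa [H.mul_mem_cancel_right hg, H.mul_mem_cancel_left (H.inv_mem hg)] at hconj
  have h_even : ∀ σ, sign σ = 1 → σ ∈ H := by
    intro σ hσ
    by_cases hσa : σ a = a
    · exact h_even_fix σ hσ hσa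
    obtain ⟨y, hy⟩ : ∃ y, y ∉ ({a, σ a} : Finset (Fin n)) := by
      by_contra! h
      have h_le := (Finset.card_le_card fun c (_ : c ∈ Finset.univ) => h c).trans
        Finset.card_le_two
      rw [Finset.card_univ] at h_le
      lia
    simp only [Finset.mem_insert, Finset.mem_singleton, not_or] at hy
    obtain ⟨τ, hτ, hτy, hτa⟩ :=
      exists_sign_eq_one_fix_map hcard (Ne.symm hy.1) (Ne.symm hy.2) (Ne.symm hσa)
    rw [← H.mul_mem_cancel_left (H.inv_mem (h_fix y τ hτ hτy))]
    apply h_even_fix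
    · simp [hσ, hτ]
    · rw [Perm.mul_apply, ← hτa, Perm.inv_eq_iff_eq]
  rw [Subgroup.eq_top_iff']
  intro g
  rcases Int.units_eq_one_or (sign g) with hg | hg
  · exact h_even g hg
  · obtain ⟨π, hπ, hπ_sign⟩ := h_odd
    rw [← H.mul_mem_cancel_left hπ]
    apply h_even
    simp [hg, hπ_sign]
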